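/- (Weighted count for an Aztec diamond with two holes.) Let n ≥ 1 and let w_0, w_1, d_0, d_1 be integers with d_0 ≥ 1, d_1 ≥ 1, w_0 ≥ 1, w_0 + d_0 ≤ n+1, 1 ≤ w_1 ≤ n, and w_1 + d_1 ≤ n+1. Let G' be the induced subgraph of the Aztec diamond graph AD_n obtained by deleting the white vertex (w_0, w_1 + d_1) and the black vertex (w_0 + d_0, w_1). For a perfect matching T of G', let w(T) be the total number of edges of T of the following four kinds: edges joining white (i-1, w_1+1) to black (i, w_1) with 1 < i < w_0 + d_0; edges joining white (i, w_1+1) to black (i, w_1) with 1 ≤ i < w_0 + d_0; edges joining white (i, w_1+d_1) to black (i, w_1+d_1-1) with 1 ≤ i < w_0; and edges joining white (i, w_1+d_1) to black (i+1, w_1+d_1-1) with 1 ≤ i < w_0. Then the sum of (-1)^{w(T)} over all perfect matchings T of G' equals (-1)^{w_1 + 1} · 2^{n(n-1)/2} · Σ_{j=0}^{w_0 - 1} Kr(j, n, w_1 + d_1 - 1) · Kr(w_1 - 1, n-1, n - (j + d_0)). -/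

import Mathlib

open scoped Classical

def adjC (p q : ℕ × ℕ) : Prop :=
  (q.1 = p.1 ∨ q.1 = p.1 + 1) ∧ (q.2 + 1 = p.2 ∨ q.2 = p.2)

def coloredGrid : SimpleGraph (Bool × ℕ × ℕ) where
  Adj u v := (u.1 = false ∧ v.1 = true ∧ adjC u.2 v.2) ∨
             (v.1 = false ∧ u.1 = true ∧ adjC v.2 u.2)
  symm := by constructor; intro u v h; tauto
  loopless := by constructor; intro u h; rcases h with ⟨h1, h2, -⟩ | ⟨h1, h2, -⟩ <;> simp [h1] at h2

noncomputable def matchCount {V : Type*} (G : SimpleGraph V) (S : Set V) : ℕ :=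
  Nat.card {M : G.Subgraph // M.verts = S ∧ M.IsMatching}

def aztecVerts (n : ℕ) : Set (Bool × ℕ × ℕ) :=
  {v | (v.1 = false ∧ 1 ≤ v.2.1 ∧ v.2.1 ≤ n ∧ 1 ≤ v.2.2 ∧ v.2.2 ≤ n + 1) ∨
       (v.1 = true ∧ 1 ≤ v.2.1 ∧ v.2.1 ≤ n + 1 ∧ 1 ≤ v.2.2 ∧ v.2.2 ≤ n)}

noncomputable def Kr (a b c : ℕ) : ℤ :=
  ((1 - Polynomial.X) ^ c * (1 + Polynomial.X) ^ (b - c) : Polynomial ℤ).coeff a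

theorem Kr_zero_succ {m c : ℕ} (h : c ≤ m) : Kr 0 (m + 1) c = Kr 0 m c := by
  simp [Kr, Nat.succ_sub h, pow_succ, Polynomial.mul_coeff_zero]

theorem Kr_zero_succ_succ (m c : ℕ) : Kr 0 (m + 1) (c + 1) = Kr 0 m c := by
  simp [Kr, pow_succ, Polynomial.mul_coeff_zero]

theorem Kr_succ_succ {m c : ℕ} (a : ℕ) (h : c ≤ m) :
    Kr (a + 1) (m + 1) c = Kr (a + 1) m c + Kr a m c := by
  simp only [Kr, Nat.succ_sub h, pow_succ]
  rw [← mul_assoc, mul_add, mul_one, Polynomial.coeff_add, Polynomial.coeff_mul_X]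

theorem Kr_succ_succ_succ (a m c : ℕ) :
    Kr (a + 1) (m + 1) (c + 1) = Kr (a + 1) m c - Kr a m c := by
  simp only [Kr, Nat.add_sub_add_right, pow_succ]
  rw [mul_right_comm, mul_sub, mul_one, Polynomial.coeff_sub, Polynomial.coeff_mul_X]

theorem Kr_eq_zero_of_lt {a m c : ℕ} (h : c ≤ m) (ha : m < a) : Kr a m c = 0 := by
  apply Polynomial.coeff_eq_zero_of_natDegree_lt
  refine lt_of_le_of_lt ?_ ha
  have h1 : (1 - Polynomial.X : Polynomial ℤ).natDegree ≤ 1 := by compute_degree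
  have h2 : (1 + Polynomial.X : Polynomial ℤ).natDegree ≤ 1 := by compute_degree
  calc _ ≤ c * 1 + (m - c) * 1 :=
        Polynomial.natDegree_mul_le_of_le (Polynomial.natDegree_pow_le_of_le c h1)
          (Polynomial.natDegree_pow_le_of_le (m - c) h2)
    _ = m := by omega

/-- The homogeneous generating function of the Krawtchouk coefficients. -/
theorem sum_Kr_mul_pow {R : Type*} [CommRing R] (u v : R) {m c : ℕ} (h : c ≤ m) :
    ∑ j ∈ Finset.range (m + 1), (Kr j m c : R) * u ^ j * v ^ (m - j) =
      (v - u) ^ c * (v + u) ^ (m - c) := by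
  induction m generalizing c with
  | zero => obtain rfl : c = 0 := by omega
            simp [Kr]
  | succ m ih =>
    have key : ∀ (ε : ℤ) (c' : ℕ), c' ≤ m → Kr 0 (m + 1) c = Kr 0 m c' →
        (∀ a, Kr (a + 1) (m + 1) c = Kr (a + 1) m c' + ε * Kr a m c') →
        ∑ j ∈ Finset.range (m + 1 + 1), (Kr j (m + 1) c : R) * u ^ j * v ^ (m + 1 - j) =
          (v + ε * u) * ((v - u) ^ c' * (v + u) ^ (m - c')) := by
      intro ε c' hc' h0 h1
      rw [← ih hc', add_mul, Finset.sum_range_succ', h0]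
      simp only [h1]
      have e1 : v * ∑ j ∈ Finset.range (m + 1), (Kr j m c' : R) * u ^ j * v ^ (m - j) =
          ∑ j ∈ Finset.range (m + 1 + 1), (Kr j m c' : R) * u ^ j * v ^ (m + 1 - j) := by
        rw [Finset.sum_range_succ _ (m + 1), Kr_eq_zero_of_lt hc' (Nat.lt_succ_self m), Finset.mul_sum]
        simp only [Int.cast_zero, zero_mul, add_zero]
        refine Finset.sum_congr rfl fun j hj => ?_
        rw [Finset.mem_range] at hj
        rw [Nat.succ_sub (by omega : j ≤ m), pow_succ]
        ring
      rw [e1, Finset.sum_range_succ' _ (m + 1), Finset.mul_sum, add_right_comm,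
        ← Finset.sum_add_distrib]
      congr 1
      refine Finset.sum_congr rfl fun j _ => ?_
      rw [Nat.add_sub_add_right]
      push_cast
      ring
    rcases Nat.eq_zero_or_pos c with rfl | hc
    · rw [key 1 0 (by omega) (Kr_zero_succ (by omega))
        (fun a => by rw [one_mul]; exact Kr_succ_succ a (by omega))]
      simp [pow_succ]; ring
    · obtain ⟨c, rfl⟩ : ∃ d, c = d + 1 := ⟨c - 1, by omega⟩
      rw [key (-1) c (by omega) (Kr_zero_succ_succ m c)
        (fun a => by rw [Kr_succ_succ_succ]; ring)]
      rw [Nat.add_sub_add_right, pow_succ (v - u)]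
      push_cast
      ring

open Polynomial in
theorem sum_Kr_mul_Kr {m a c : ℕ} (hc : c ≤ m) :
    ∑ j ∈ Finset.range (m + 1), Kr a m j * Kr j m c = if a = c then 2 ^ m else 0 := by
  have h := congrArg (fun p : ℤ[X] => p.coeff a)
    (sum_Kr_mul_pow (1 - X : ℤ[X]) (1 + X) hc)
  simp only [Polynomial.finsetSum_coeff] at h
  have e : (1 + X - (1 - X) : ℤ[X]) ^ c * (1 + X + (1 - X)) ^ (m - c) = C (2 ^ m) * X ^ c := by
    have h1 : (1 + X - (1 - X) : ℤ[X]) = 2 * X := by ring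
    have h2 : (1 + X + (1 - X) : ℤ[X]) = 2 := by ring
    rw [h1, h2, mul_pow, mul_right_comm, ← pow_add, Nat.add_sub_cancel' hc]
    simp
  rw [e, coeff_C_mul_X_pow] at h
  rw [← h]
  refine Finset.sum_congr rfl fun j _ => ?_
  rw [mul_assoc, ← Polynomial.C_eq_intCast, coeff_C_mul, mul_comm]
  simp [Kr]

open Polynomial in
theorem Kr_reflect {m a c : ℕ} (hc : c ≤ m) (ha : a ≤ m) :
    Kr (m - a) m c = (-1) ^ c * Kr a m c := by
  have h := congrArg (fun p : ℤ[X] => p.coeff a) (sum_Kr_mul_pow (1 : ℤ[X]) X hc)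
  have e : (X - 1 : ℤ[X]) ^ c * (X + 1) ^ (m - c) =
      C ((-1) ^ c) * ((1 - X) ^ c * (1 + X) ^ (m - c)) := by
    rw [add_comm X, ← neg_sub, neg_pow]
    simp [mul_assoc]
  rw [e] at h
  simp only [Polynomial.finsetSum_coeff, coeff_C_mul, one_pow, mul_one] at h
  rw [Kr, Kr, ← h, Finset.sum_eq_single (m - a)]
  · rw [← Polynomial.C_eq_intCast, coeff_C_mul_X_pow, if_pos (by omega)]
    rfl
  · intro j hj hne
    rw [Finset.mem_range] at hj
    rw [← Polynomial.C_eq_intCast, coeff_C_mul_X_pow, if_neg (by omega)]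
  · intro hn
    exact absurd (Finset.mem_range.2 (by omega)) hn

/-- White vertices of the Aztec diamond of order `m + 1`, as pairs `(y, x)` starting at `0`. -/
abbrev White (m : ℕ) : Type := Fin (m + 2) × Fin (m + 1)

/-- Black vertices of the Aztec diamond of order `m + 1`, as pairs `(y, x)` starting at `0`. -/
abbrev Black (m : ℕ) : Type := Fin (m + 1) × Fin (m + 2)

/-- A Kasteleyn matrix of the Aztec diamond graph of order `m + 1`. -/
def kasteleyn (m : ℕ) : Matrix (White m) (Black m) ℤ := fun u c =>
  if (c.2 : ℕ) = u.2 then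
    (if (c.1 : ℕ) = u.1 then 1 else 0) + (if (c.1 : ℕ) + 1 = u.1 then 1 else 0)
  else if (c.2 : ℕ) = u.2 + 1 then
    (if (c.1 : ℕ) = u.1 then 1 else 0) - (if (c.1 : ℕ) + 1 = u.1 then 1 else 0)
  else 0

noncomputable def krawtchouk (m : ℕ) : Matrix (Fin (m + 1)) (Fin (m + 1)) ℤ :=
  fun a c => Kr a m c

/-- The Kasteleyn matrix after the Krawtchouk change of basis in the vertical direction: the graph
decomposes into disjoint diagonal paths. -/
def pathMatrix (m : ℕ) : Matrix (White m) (Black m) ℤ := fun u c =>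
  (if (c.1 : ℕ) = u.1 then (if (c.2 : ℕ) = u.2 then 1 else 0) else 0) +
    (if (c.1 : ℕ) + 1 = u.1 then (if (c.2 : ℕ) = u.2 + 1 then 1 else 0) else 0)

/-- The inverse of `pathMatrix`. -/
def pathInverse (m : ℕ) : Matrix (Black m) (White m) ℤ := fun c u =>
  if (c.1 + c.2 : ℕ) = u.1 + u.2 then
    if (u.1 + u.2 : ℕ) < m + 1 then (if (c.2 : ℕ) ≤ u.2 then (-1) ^ (u.2 - c.2 : ℕ) else 0)
    else (if (u.2 : ℕ) < c.2 then (-1) ^ (c.2 - u.2 - 1 : ℕ) else 0)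
  else 0

theorem Fin.sum_ite_val_eq {k t : ℕ} (f : ℕ → ℤ) :
    ∑ i : Fin k, (if (i : ℕ) = t then f i else 0) = if t < k then f t else 0 := by
  rw [Fin.sum_univ_eq_sum_range (fun i => if i = t then f i else 0)]
  simp [Finset.sum_ite_eq']

theorem Fin.sum_ite_val_succ_eq {k t : ℕ} (f : ℕ → ℤ) :
    ∑ i : Fin k, (if (i : ℕ) + 1 = t then f i else 0) =
      if 1 ≤ t ∧ t ≤ k then f (t - 1) else 0 := by
  rw [Fin.sum_univ_eq_sum_range (fun i => if i + 1 = t then f i else 0)]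
  rcases t with _ | t
  · simp
  · simp [Finset.sum_ite_eq']

theorem krawtchouk_mul_self (m : ℕ) : krawtchouk m * krawtchouk m = (2 ^ m : ℤ) • 1 := by
  ext a c
  simp only [Matrix.mul_apply, krawtchouk, Matrix.smul_apply, Matrix.one_apply]
  rw [Fin.sum_univ_eq_sum_range (fun j => Kr a m j * Kr j m c),
    sum_Kr_mul_Kr (by omega)]
  simp [Fin.ext_iff]

open Kronecker in
theorem kasteleyn_mul_krawtchouk (m : ℕ) :
    kasteleyn m * (krawtchouk m ⊗ₖ (1 : Matrix (Fin (m + 2)) (Fin (m + 2)) ℤ)) =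
      (krawtchouk (m + 1) ⊗ₖ (1 : Matrix (Fin (m + 1)) (Fin (m + 1)) ℤ)) * pathMatrix m := by
  ext ⟨y, x⟩ ⟨j, x'⟩
  simp only [Matrix.mul_apply, Fintype.sum_prod_type, Matrix.kroneckerMap_apply, Matrix.one_apply,
    mul_ite, mul_one, mul_zero, ite_mul, zero_mul, Finset.sum_ite_eq', Finset.sum_ite_eq,
    Finset.mem_univ, if_true, kasteleyn, pathMatrix, krawtchouk]
  have e1 : ∀ ε : ℤ, ∑ i : Fin (m + 1), ((if (i : ℕ) = y then 1 else 0) +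
      ε * (if (i : ℕ) + 1 = y then 1 else 0)) * Kr i m j =
      Kr y m j + ε * (if 1 ≤ (y : ℕ) then Kr (y - 1) m j else 0) := by
    intro ε
    have h1 := Fin.sum_ite_val_eq (k := m + 1) (t := y) (fun i => Kr i m j)
    have h2 := Fin.sum_ite_val_succ_eq (k := m + 1) (t := y) (fun i => Kr i m j)
    simp only [add_mul, mul_assoc, ite_mul, one_mul, zero_mul, Finset.sum_add_distrib,
      ← Finset.mul_sum, h1, h2]
    congr 1
    · split_ifs with h
      · rfl
      · rw [Kr_eq_zero_of_lt] <;> omega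
    · grind
  have e2 : ∀ j' : ℕ, j' < m + 2 → ∑ i : Fin (m + 2), (if j' = (i : ℕ) then Kr y (m + 1) i else 0) =
      Kr y (m + 1) j' := by
    intro j' hj'
    have h1 := Fin.sum_ite_val_eq (k := m + 2) (t := j') (fun i => Kr y (m + 1) i)
    simp only [eq_comm (a := j'), h1, hj', if_true]
  by_cases hx : (x' : ℕ) = x
  · have hx1 : ¬ (x' : ℕ) = x + 1 := by omega
    have h := e1 1
    simp only [one_mul] at h
    simp only [hx, if_true, h, mul_add, mul_ite, mul_one, mul_zero]
    simp only [ite_self, Nat.left_eq_add, one_ne_zero, if_false, add_zero, e2 j (by omega)]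
    rcases hy : (y : ℕ) with _ | y'
    · simp [Kr_zero_succ (show (j : ℕ) ≤ m by omega)]
    · simp [Kr_succ_succ _ (show (j : ℕ) ≤ m by omega)]
  · by_cases hx1 : (x' : ℕ) = x + 1
    · have h := e1 (-1)
      simp only [neg_mul, one_mul, ← sub_eq_add_neg] at h
      simp only [hx1, if_true, if_false, h, mul_add, mul_ite, mul_one, mul_zero,
        Nat.add_eq_left, one_ne_zero]
      simp only [ite_self, zero_add, e2 (j + 1) (by omega)]
      rcases hy : (y : ℕ) with _ | y'
      · simp [Kr_zero_succ_succ]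
      · simp [Kr_succ_succ_succ]
    · simp [hx, hx1]

theorem pathMatrix_mul_pathInverse (m : ℕ) : pathMatrix m * pathInverse m = 1 := by
  ext ⟨j, x⟩ ⟨j₀, x₀⟩
  have h1 : ∀ (f : ℕ → ℕ → ℤ), ∑ c : Black m, pathMatrix m (j, x) c * f c.1 c.2 =
      (if (j : ℕ) < m + 1 then f j x else 0) +
        if 1 ≤ (j : ℕ) ∧ (j : ℕ) ≤ m + 1 then f (j - 1) (x + 1) else 0 := by
    intro f
    simp only [Fintype.sum_prod_type, pathMatrix, add_mul, ite_mul, one_mul, zero_mul,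
      Finset.sum_add_distrib]
    have a1 : ∀ i : Fin (m + 1), ∑ k : Fin (m + 2), (if (i : ℕ) = j then
        (if (k : ℕ) = x then f i k else 0) else 0) = if (i : ℕ) = j then f i x else 0 := by
      intro i
      have := Fin.sum_ite_val_eq (k := m + 2) (t := x) (fun k => f i k)
      split_ifs <;> simp [this]; omega
    have a2 : ∀ i : Fin (m + 1), ∑ k : Fin (m + 2), (if (i : ℕ) + 1 = j then
        (if (k : ℕ) = x + 1 then f i k else 0) else 0) =
          if (i : ℕ) + 1 = j then f i (x + 1) else 0 := by
      intro i
      have := Fin.sum_ite_val_eq (k := m + 2) (t := x + 1) (fun k => f i k)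
      split_ifs <;> simp [this]; omega
    simp only [a1, a2]
    rw [Fin.sum_ite_val_eq (fun i => f i x), Fin.sum_ite_val_succ_eq (fun i => f i (x + 1))]
  have h2 := h1 (fun c1 c2 => if c1 + c2 = j₀ + x₀ then
    if (j₀ + x₀ : ℕ) < m + 1 then (if c2 ≤ x₀ then (-1) ^ (x₀ - c2 : ℕ) else 0)
    else (if (x₀ : ℕ) < c2 then (-1) ^ (c2 - x₀ - 1 : ℕ) else 0)
  else 0)
  rw [Matrix.mul_apply]
  refine h2.trans ?_
  clear h1 h2
  obtain ⟨j, hj⟩ := j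
  obtain ⟨x, hx⟩ := x
  obtain ⟨j₀, hj₀⟩ := j₀
  obtain ⟨x₀, hx₀⟩ := x₀
  simp only [Matrix.one_apply, Prod.mk.injEq, Fin.mk.injEq]
  have p1 : x < x₀ → (-1 : ℤ) ^ (x₀ - x) = - (-1) ^ (x₀ - (x + 1)) := by
    intro h
    rw [show x₀ - x = (x₀ - (x + 1)) + 1 by omega, pow_succ]; ring
  have p2 : x₀ < x → (-1 : ℤ) ^ (x + 1 - x₀ - 1) = - (-1) ^ (x - x₀ - 1) := by
    intro h
    rw [show x + 1 - x₀ - 1 = (x - x₀ - 1) + 1 by omega, pow_succ]; ring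
  rcases lt_trichotomy x x₀ with h | rfl | h
  · grind
  · by_cases hjj : j = j₀
    · subst hjj
      by_cases h : j + x < m + 1
      · have : j < m + 1 := by omega
        simp [h, this]
      · by_cases h1 : j < m + 1
        · have h3 : 1 ≤ j ∧ j ≤ m + 1 := by omega
          have h4 : j - 1 + (x + 1) = j + x := by omega
          simp [h, h1, h3, h4]
        · have h3 : 1 ≤ j ∧ j ≤ m + 1 := by omega
          have h4 : j - 1 + (x + 1) = j + x := by omega
          simp [h, h1, h3, h4]
    · have h4 : 1 ≤ j ∧ j ≤ m + 1 → ¬ j - 1 + (x + 1) = j₀ + x := by omega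
      have h5 : ¬ j + x = j₀ + x := by omega
      simp +contextual [hjj, h4]
  · grind

open Kronecker in
/-- The inverse of the Kasteleyn matrix, up to the factor `2 ^ (m + 1)`. -/
noncomputable def green (m : ℕ) : Matrix (Black m) (White m) ℤ :=
  (krawtchouk m ⊗ₖ (1 : Matrix (Fin (m + 2)) (Fin (m + 2)) ℤ)) * pathInverse m *
    (krawtchouk (m + 1) ⊗ₖ (1 : Matrix (Fin (m + 1)) (Fin (m + 1)) ℤ))

theorem kasteleyn_mul_green (m : ℕ) : kasteleyn m * green m = (2 ^ (m + 1) : ℤ) • 1 := by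
  rw [green, ← Matrix.mul_assoc, ← Matrix.mul_assoc, kasteleyn_mul_krawtchouk,
    Matrix.mul_assoc _ (pathMatrix m),
    pathMatrix_mul_pathInverse, Matrix.mul_one, ← Matrix.mul_kronecker_mul, krawtchouk_mul_self,
    Matrix.mul_one, Matrix.smul_kronecker, Matrix.one_kronecker_one]

/-- The bijection between white and black vertices preserving the row by row numbering. -/
def whiteEquivBlack (m : ℕ) : White m ≃ Black m :=
  finProdFinEquiv.trans ((finCongr (mul_comm _ _)).trans finProdFinEquiv.symm)

def kasteleynSquare (m : ℕ) : Matrix (White m) (White m) ℤ :=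
  (kasteleyn m).submatrix id (whiteEquivBlack m)

theorem adjugate_kasteleynSquare (m : ℕ) (b : Black m) (w : White m) :
    2 ^ (m + 1) * (kasteleynSquare m).adjugate ((whiteEquivBlack m).symm b) w =
      (kasteleynSquare m).det * green m b w := by
  have h : kasteleynSquare m * (green m).submatrix (whiteEquivBlack m) id =
      (2 ^ (m + 1) : ℤ) • 1 := by
    rw [kasteleynSquare, Matrix.submatrix_mul_equiv, kasteleyn_mul_green, Matrix.submatrix_id_id]
  have h2 := congrArg (fun M => (kasteleynSquare m).adjugate * M) h
  simp only [← Matrix.mul_assoc, Matrix.adjugate_mul, Matrix.smul_mul, Matrix.one_mul,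
    Matrix.mul_smul, Matrix.mul_one] at h2
  have h3 := congrFun (congrFun h2 ((whiteEquivBlack m).symm b)) w
  simpa using h3.symm

theorem det_krawtchouk_sq (m : ℕ) : (krawtchouk m).det ^ 2 = 2 ^ (m * (m + 1)) := by
  have h := congrArg Matrix.det (krawtchouk_mul_self m)
  rw [Matrix.det_mul, Matrix.det_smul, Matrix.det_one, mul_one, Fintype.card_fin, ← pow_mul] at h
  rw [sq, h]

theorem det_kasteleynSquare_sq (m : ℕ) :
    (kasteleynSquare m).det ^ 2 = 2 ^ ((m + 1) * (m + 2)) := by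
  set e := whiteEquivBlack m
  have hP : ((pathMatrix m).submatrix id e).det ^ 2 = 1 := by
    have h : (pathMatrix m).submatrix id e * (pathInverse m).submatrix e id = 1 := by
      rw [Matrix.submatrix_mul_equiv, pathMatrix_mul_pathInverse, Matrix.submatrix_id_id]
    have h' := congrArg Matrix.det h
    rw [Matrix.det_mul, Matrix.det_one] at h'
    rcases Int.isUnit_iff.1 (IsUnit.of_mul_eq_one _ h') with h1 | h1 <;> rw [h1] <;> norm_num
  have h := congrArg (fun M => (M.submatrix id e).det ^ 2) (kasteleyn_mul_krawtchouk m)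
  rw [← Matrix.submatrix_mul_equiv _ _ id e e,
    ← Matrix.submatrix_mul_equiv _ _ id (Equiv.refl _) e] at h
  simp only [Matrix.det_mul, mul_pow, Matrix.det_submatrix_equiv_self, Matrix.det_kronecker,
    Matrix.det_one, one_pow, mul_one, Fintype.card_fin, Equiv.coe_refl, Matrix.submatrix_id_id,
    hP] at h
  rw [← pow_mul, ← pow_mul, mul_comm (m + 2) 2, mul_comm (m + 1) 2, pow_mul _ 2, pow_mul _ 2,
    det_krawtchouk_sq, det_krawtchouk_sq, ← pow_mul, ← pow_mul] at h
  have h2 : (2 : ℤ) ^ (m * (m + 1) * (m + 2)) ≠ 0 := by positivity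
  apply mul_right_cancel₀ h2
  rw [← pow_add]
  refine h.trans ?_
  congr 1
  ring

theorem green_apply (m : ℕ) (b : Black m) (w : White m) (h : (w.2 : ℕ) < b.2) :
    green m b w = (-1) ^ (w.1 + (b.2 - w.2 - 1) : ℕ) * ∑ j ∈ Finset.range (w.2 + 1),
      Kr j (m + 1) w.1 * Kr b.1 m (m + 1 - (j + (b.2 - w.2))) := by
  obtain ⟨y', x'⟩ := b
  obtain ⟨y, x⟩ := w
  simp only at h ⊢
  simp only [green, Matrix.mul_apply, Fintype.sum_prod_type, Matrix.kroneckerMap_apply,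
    Matrix.one_apply, mul_ite, mul_one, mul_zero, ite_mul, zero_mul, Finset.sum_ite_eq',
    Finset.sum_ite_eq, Finset.mem_univ, if_true, krawtchouk]
  simp only [pathInverse, mul_ite, mul_zero]
  have h1 : ∀ j : Fin (m + 2), ∑ i : Fin (m + 1), (if (i + x' : ℕ) = j + x then
      if (j + x : ℕ) < m + 1 then (if (x' : ℕ) ≤ x then Kr y' m i * (-1) ^ (x - x' : ℕ) else 0)
      else (if (x : ℕ) < x' then Kr y' m i * (-1) ^ (x' - x - 1 : ℕ) else 0)
      else 0) = if (j + x : ℕ) < m + 1 then 0 else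
        Kr y' m (j - (x' - x)) * (-1) ^ (x' - x - 1 : ℕ) := by
    intro j
    by_cases hj : (j + x : ℕ) < m + 1
    · simp [hj, not_le.2 h]
    · have e := Fin.sum_ite_val_eq (k := m + 1) (t := j - (x' - x))
        (fun i => Kr y' m i * (-1) ^ (x' - x - 1 : ℕ))
      rw [if_pos (by omega)] at e
      simp only [hj, if_false, h, if_true]
      rw [← e]
      refine Finset.sum_congr rfl fun i _ => ?_
      congr 1
      simp only [eq_iff_iff]
      omega
  simp only [h1]
  rw [Fin.sum_univ_eq_sum_range (fun j => (if (j + x : ℕ) < m + 1 then 0 else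
        Kr y' m (j - (x' - x)) * (-1) ^ (x' - x - 1 : ℕ)) * Kr j (m + 1) y), ← Finset.sum_range_reflect,
    Finset.mul_sum]
  symm
  refine Finset.sum_subset_zero_on_sdiff ?_ ?_ ?_
  · intro j; simp only [Finset.mem_range]; omega
  · intro j hj
    simp only [Finset.mem_sdiff, Finset.mem_range] at hj
    rw [if_pos (by omega), zero_mul]
  · intro j hj
    rw [Finset.mem_range] at hj
    rw [if_neg (by omega), show m + 2 - 1 - j = m + 1 - j by omega,
      Kr_reflect (by omega) (by omega), pow_add,
      ← Nat.sub_sub (m + 1) j]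
    ring

/-- The sign of a permutation counts the inversions with respect to an injective labelling. -/
theorem sign_eq_neg_one_pow_card_inversions {ι : Type*} [Fintype ι] [DecidableEq ι] (l : ι → ℕ)
    (hl : Function.Injective l) (τ : Equiv.Perm ι) :
    (Equiv.Perm.sign τ : ℤ) =
      (-1) ^ (∑ u, ∑ v, if l u < l v ∧ l (τ v) < l (τ u) then 1 else 0) := by
  let : LinearOrder ι := LinearOrder.lift' l hl
  have hlt : ∀ u v : ι, u < v ↔ l u < l v := fun _ _ => Iff.rfl
  let f := Fintype.orderIsoFinOfCardEq ι rfl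
  have h1 : Equiv.Perm.sign τ = Equiv.Perm.sign (f.toEquiv.symm.permCongr τ) := by
    rw [Equiv.Perm.sign_permCongr]
  rw [h1, Equiv.Perm.sign_eq_prod_prod_Iio, Finset.sum_comm, ← Finset.prod_pow_eq_pow_sum,
    Units.coe_prod, ← f.toEquiv.prod_comp]
  refine Finset.prod_congr rfl fun j _ => ?_
  rw [← Finset.prod_pow_eq_pow_sum, ← f.toEquiv.prod_comp, Units.coe_prod,
    ← Finset.prod_subset (Finset.subset_univ (Finset.Iio j))]
  · refine Finset.prod_congr rfl fun i hi => ?_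
    have hi' : l (f i) < l (f j) := (hlt _ _).1 (f.lt_iff_lt.2 (by simpa using hi))
    have hij : l (τ (f i)) ≠ l (τ (f j)) := fun h => hi'.ne (congrArg l (τ.injective (hl h)))
    have e : (f.toEquiv.symm.permCongr τ) i < (f.toEquiv.symm.permCongr τ) j ↔
        l (τ (f i)) < l (τ (f j)) := by
      rw [← hlt]
      exact f.symm.lt_iff_lt
    by_cases hc : l (τ (f i)) < l (τ (f j))
    · rw [if_pos (e.2 hc), if_neg (fun h => hc.asymm h.2)]
      rfl
    · rw [if_neg (fun h => hc (e.1 h)), if_pos ⟨hi', lt_of_le_of_ne (not_lt.1 hc) hij.symm⟩]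
      rfl
  · intro i _ hi
    have hi' : ¬ l (f i) < l (f j) := by
      rw [← hlt, f.lt_iff_lt]; simpa using hi
    simp [hi']

/-- The row by row numbering of the white vertices. -/
def whiteLabel {m : ℕ} (u : White m) : ℕ := u.2 + (m + 1) * u.1

/-- The row by row numbering of the black vertices. -/
def blackLabel {m : ℕ} (c : Black m) : ℕ := c.2 + (m + 2) * c.1

theorem add_mul_lt_add_mul_iff {k x x' y y' : ℕ} (hx : x < k) (hx' : x' < k) :
    x + k * y < x' + k * y' ↔ y < y' ∨ (y = y' ∧ x < x') := by
  rcases lt_trichotomy y y' with h | rfl | h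
  · have : k * (y + 1) ≤ k * y' := Nat.mul_le_mul_left k h
    rw [mul_add] at this
    simp only [h, true_or, iff_true]
    omega
  · simp
  · have : k * (y' + 1) ≤ k * y := Nat.mul_le_mul_left k h
    rw [mul_add] at this
    constructor <;> intro <;> omega

theorem whiteLabel_lt_iff {m : ℕ} (u v : White m) : whiteLabel u < whiteLabel v ↔
    (u.1 : ℕ) < v.1 ∨ ((u.1 : ℕ) = v.1 ∧ (u.2 : ℕ) < v.2) :=
  add_mul_lt_add_mul_iff u.2.2 v.2.2

theorem blackLabel_lt_iff {m : ℕ} (u v : Black m) : blackLabel u < blackLabel v ↔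
    (u.1 : ℕ) < v.1 ∨ ((u.1 : ℕ) = v.1 ∧ (u.2 : ℕ) < v.2) :=
  add_mul_lt_add_mul_iff u.2.2 v.2.2

theorem whiteLabel_injective {m : ℕ} : Function.Injective (whiteLabel (m := m)) := by
  intro u v h
  have h1 := whiteLabel_lt_iff u v
  have h2 := whiteLabel_lt_iff v u
  ext <;> omega

theorem blackLabel_whiteEquivBlack {m : ℕ} (u : White m) :
    blackLabel (whiteEquivBlack m u) = whiteLabel u := by
  have h : ((finProdFinEquiv (whiteEquivBlack m u) : Fin _) : ℕ) = (finProdFinEquiv u : Fin _) := by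
    simp [whiteEquivBlack, -finProdFinEquiv_symm_apply, -finProdFinEquiv_apply_val]
  simpa [blackLabel, whiteLabel] using h

theorem card_whiteLabel_lt {m : ℕ} (w : White m) :
    (Finset.univ.filter fun u : White m => whiteLabel u < whiteLabel w).card = whiteLabel w := by
  have h : ∀ u : White m, whiteLabel u = (finProdFinEquiv u : Fin _) := by
    intro u; simp [whiteLabel]
  simp only [h]
  rw [← Fintype.card_subtype, Fintype.card_congr (finProdFinEquiv.subtypeEquiv
    (p := fun u : White m => (finProdFinEquiv u : ℕ) < (finProdFinEquiv w : ℕ))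
    (q := fun i => i < finProdFinEquiv w) (fun _ => Iff.rfl))]
  rw [Fintype.card_subtype, Finset.filter_gt_eq_Iio, Fin.card_Iio]

/-- The adjacency of the Aztec diamond graph, in 0-indexed coordinates. -/
def Adjacent {m : ℕ} (u : White m) (c : Black m) : Prop :=
  ((c.2 : ℕ) = u.2 ∨ (c.2 : ℕ) = u.2 + 1) ∧ ((c.1 : ℕ) + 1 = u.1 ∨ (c.1 : ℕ) = u.1)

theorem card_filter_white_row_lt {m : ℕ} (v : White m) :
    (Finset.univ.filter fun u : White m => (u.1 : ℕ) = v.1 ∧ (u.2 : ℕ) < v.2).card = v.2 := by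
  have : (Finset.univ.filter fun u : White m => (u.1 : ℕ) = v.1 ∧ (u.2 : ℕ) < v.2) =
      {v.1} ×ˢ Finset.Iio v.2 := by
    ext ⟨a, b⟩
    simp only [Finset.mem_filter, Finset.mem_univ, true_and, Finset.mem_product,
      Finset.mem_singleton, Finset.mem_Iio, Fin.lt_def, Fin.ext_iff]
  rw [this, Finset.card_product]; simp

theorem card_filter_black_row_gt {m : ℕ} (v : Black m) :
    (Finset.univ.filter fun u : Black m => (u.1 : ℕ) = v.1 ∧ (v.2 : ℕ) < u.2).card
      = m + 1 - v.2 := by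
  have : (Finset.univ.filter fun u : Black m => (u.1 : ℕ) = v.1 ∧ (v.2 : ℕ) < u.2) =
      {v.1} ×ˢ Finset.Ioi v.2 := by
    ext ⟨a, b⟩
    simp only [Finset.mem_filter, Finset.mem_univ, true_and, Finset.mem_product,
      Finset.mem_singleton, Finset.mem_Ioi, Fin.lt_def, Fin.ext_iff]
  rw [this, Finset.card_product]; simp

theorem inversion_indicator {m : ℕ} (σ : White m ≃ Black m) (p : White m → Prop)
    [DecidablePred p]
    (hadj : ∀ u, p u → Adjacent u (σ u)) (u v : White m) :
    (if p u ∧ p v ∧ whiteLabel u < whiteLabel v ∧ blackLabel (σ v) < blackLabel (σ u)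
        then 1 else 0) +
      (if ¬ p u ∧ (p v ∧ ((σ v).1 : ℕ) + 1 = v.1) ∧ (u.1 : ℕ) = v.1 ∧ (u.2 : ℕ) < v.2
        then 1 else 0) +
      (if ¬ p u ∧ (p v ∧ ((σ v).1 : ℕ) + 1 = v.1) ∧ ((σ u).1 : ℕ) = (σ v).1 ∧
        ((σ v).2 : ℕ) < (σ u).2 then 1 else 0) +
      ((if (p u ∧ ((σ u).1 : ℕ) + 1 = u.1) ∧ (p v ∧ ((σ v).1 : ℕ) + 1 = v.1) ∧
        (u.1 : ℕ) = v.1 ∧ (u.2 : ℕ) < v.2 then 1 else 0) +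
      (if (p v ∧ ((σ v).1 : ℕ) + 1 = v.1) ∧ (p u ∧ ((σ u).1 : ℕ) + 1 = u.1) ∧
        (v.1 : ℕ) = u.1 ∧ (v.2 : ℕ) < u.2 then 1 else 0)) =
      (if (p v ∧ ((σ v).1 : ℕ) + 1 = v.1) ∧ (u.1 : ℕ) = v.1 ∧ (u.2 : ℕ) < v.2
        then 1 else 0) +
      (if (p v ∧ ((σ v).1 : ℕ) + 1 = v.1) ∧ ((σ u).1 : ℕ) = (σ v).1 ∧
        ((σ v).2 : ℕ) < (σ u).2 then 1 else 0) := by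
  simp only [whiteLabel_lt_iff, blackLabel_lt_iff]
  have hu := hadj u
  have hv := hadj v
  have hinj : ((σ u).1 : ℕ) = (σ v).1 → ((σ u).2 : ℕ) = (σ v).2 →
      (u.1 : ℕ) = v.1 ∧ (u.2 : ℕ) = v.2 := by
    intro h1 h2
    have : u = v := σ.injective (Prod.ext (Fin.ext h1) (Fin.ext h2))
    simp [this]
  have hfun : (u.1 : ℕ) = v.1 → (u.2 : ℕ) = v.2 → ((σ u).2 : ℕ) = (σ v).2 := by
    intro h1 h2
    have : u = v := Prod.ext (Fin.ext h1) (Fin.ext h2)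
    rw [this]
  simp only [Adjacent] at hu hv
  generalize ((σ u).1 : ℕ) = a at *
  generalize ((σ u).2 : ℕ) = b at *
  generalize ((σ v).1 : ℕ) = c at *
  generalize ((σ v).2 : ℕ) = d at *
  generalize (u.1 : ℕ) = y at *
  generalize (u.2 : ℕ) = x at *
  generalize (v.1 : ℕ) = y' at *
  generalize (v.2 : ℕ) = x' at *
  clear hadj
  by_cases hpv : p v
  · by_cases hpu : p u
    · have hu' := hu hpu
      have hv' := hv hpv
      clear hu hv
      simp only [hpu, hpv, true_and, not_true_eq_false, false_and, if_false]
      obtain ⟨h1, h2⟩ := hu'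
      obtain ⟨h3, h4⟩ := hv'
      rcases h2 with h2 | h2 <;> rcases h4 with h4 | h4 <;> subst h2 <;> subst h4
      · simp only [true_and]
        split_ifs <;> omega
      · have e1 : ¬ c + 1 = c := by omega
        simp only [e1, false_and, and_false, if_false]
        split_ifs <;> omega
      · have e1 : ¬ a + 1 = a := by omega
        simp only [e1, false_and, and_false, if_false, true_and]
        split_ifs <;> omega
      · have e1 : ¬ c + 1 = c := by omega
        simp only [e1, false_and, and_false, if_false]
        split_ifs <;> omega
    · simp [hpu, hpv]
  · simp [hpv]

theorem sum_inversions {m : ℕ} (σ : White m ≃ Black m) (p : White m → Prop)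
    [DecidablePred p]
    (hadj : ∀ u, p u → Adjacent u (σ u)) :
    (∑ u, ∑ v, if p u ∧ p v ∧ whiteLabel u < whiteLabel v ∧ blackLabel (σ v) < blackLabel (σ u)
        then 1 else 0) +
      (∑ u, ∑ v, if ¬ p u ∧ (p v ∧ ((σ v).1 : ℕ) + 1 = v.1) ∧ (u.1 : ℕ) = v.1 ∧ (u.2 : ℕ) < v.2
        then 1 else 0) +
      (∑ u, ∑ v, if ¬ p u ∧ (p v ∧ ((σ v).1 : ℕ) + 1 = v.1) ∧ ((σ u).1 : ℕ) = (σ v).1 ∧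
        ((σ v).2 : ℕ) < (σ u).2 then 1 else 0) +
      2 * (∑ u, ∑ v, if (p u ∧ ((σ u).1 : ℕ) + 1 = u.1) ∧ (p v ∧ ((σ v).1 : ℕ) + 1 = v.1) ∧
        (u.1 : ℕ) = v.1 ∧ (u.2 : ℕ) < v.2 then 1 else 0) =
      ∑ v, if p v ∧ ((σ v).1 : ℕ) + 1 = v.1 then (v.2 : ℕ) + (m + 1 - (σ v).2) else 0 := by
  have h := Finset.sum_congr (rfl : (Finset.univ : Finset (White m)) = Finset.univ) fun u _ =>
    Finset.sum_congr (rfl : (Finset.univ : Finset (White m)) = Finset.univ) fun v _ =>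
      inversion_indicator σ p hadj u v
  simp only [Finset.sum_add_distrib] at h
  rw [two_mul]
  nth_rewrite 5 [Finset.sum_comm]
  refine h.trans ?_
  rw [Finset.sum_comm]
  nth_rewrite 2 [Finset.sum_comm]
  rw [← Finset.sum_add_distrib]
  refine Finset.sum_congr rfl fun v _ => ?_
  by_cases hv : p v ∧ ((σ v).1 : ℕ) + 1 = v.1
  · simp only [hv, true_and, and_self, if_true, ← Finset.card_filter]
    congr 1
    · exact card_filter_white_row_lt v
    · rw [← card_filter_black_row_gt (σ v)]
      refine Finset.card_bij (fun u _ => σ u) ?_ ?_ ?_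
      · intro u hu; simpa using hu
      · intro u _ u' _ h; exact σ.injective h
      · intro c hc; exact ⟨σ.symm c, by simpa using hc, by simp⟩
  · simp only [hv, false_and, if_false, Finset.sum_const_zero, add_zero]

/-- The number of edges `u — σ u`, `p u`, going from a row of black vertices to the row of white
vertices above it. -/
noncomputable def downCount {m : ℕ} (σ : White m ≃ Black m) (p : White m → Prop)
    [DecidablePred p] : ℕ :=
  ∑ v, if p v ∧ ((σ v).1 : ℕ) + 1 = v.1 then 1 else 0

theorem neg_one_pow_mul_self (k : ℕ) : (-1 : ℤ) ^ k * (-1) ^ k = 1 := by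
  rw [← pow_add, ← two_mul, pow_mul, neg_one_sq, one_pow]

theorem neg_one_pow_inversions_mul_prod {m : ℕ} (σ : White m ≃ Black m) (p : White m → Prop)
    [DecidablePred p]
    (hadj : ∀ u, p u → Adjacent u (σ u)) :
    (-1 : ℤ) ^ (∑ u, ∑ v, if p u ∧ p v ∧ whiteLabel u < whiteLabel v ∧
      blackLabel (σ v) < blackLabel (σ u) then 1 else 0) *
      ∏ u, (if p u then kasteleyn m u (σ u) else 1) =
    (-1) ^ ((m + 1) * downCount σ p +
      (∑ u, ∑ v, if ¬ p u ∧ (p v ∧ ((σ v).1 : ℕ) + 1 = v.1) ∧ (u.1 : ℕ) = v.1 ∧ (u.2 : ℕ) < v.2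
        then 1 else 0) +
      (∑ u, ∑ v, if ¬ p u ∧ (p v ∧ ((σ v).1 : ℕ) + 1 = v.1) ∧ ((σ u).1 : ℕ) = (σ v).1 ∧
        ((σ v).2 : ℕ) < (σ u).2 then 1 else 0)) := by
  have h := congrArg (fun k : ℕ => (-1 : ℤ) ^ k) (sum_inversions σ p hadj)
  simp only [pow_add, pow_mul (-1 : ℤ) 2, neg_one_sq, one_pow, mul_one] at h
  have hprod : (-1 : ℤ) ^ (∑ v, if p v ∧ ((σ v).1 : ℕ) + 1 = v.1 then
      (v.2 : ℕ) + (m + 1 - (σ v).2) else 0) * ∏ u, (if p u then kasteleyn m u (σ u) else 1) =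
      (-1) ^ ((m + 1) * downCount σ p) := by
    rw [downCount, Finset.mul_sum, ← Finset.prod_pow_eq_pow_sum, ← Finset.prod_pow_eq_pow_sum,
      ← Finset.prod_mul_distrib]
    refine Finset.prod_congr rfl fun u _ => ?_
    by_cases hp : p u
    · obtain ⟨h1, h2⟩ := hadj u hp
      have h3 : ((σ u).2 : ℕ) ≤ m + 1 := by omega
      simp only [hp, true_and, if_true, kasteleyn]
      rcases h2 with h2 | h2
      · have h4 : ¬ ((σ u).1 : ℕ) = u.1 := by omega
        rcases h1 with h1 | h1
        · simp only [h1, h2, h4, if_true, if_false]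
          rw [zero_add, mul_one, mul_one]
          congr 1
          omega
        · have h5 : ¬ ((σ u).2 : ℕ) = u.2 := by omega
          simp only [h1, h2, h4, if_true, if_false]
          rw [if_neg (by omega), mul_one, show (u.2 : ℕ) + (m + 1 - (u.2 + 1)) = m by omega,
            pow_succ]
          norm_num
      · have h4 : ¬ ((σ u).1 : ℕ) + 1 = u.1 := by omega
        simp only [h2]
        grind
    · simp [hp]
  rw [pow_add, pow_add, ← hprod, ← h]
  set A := (-1 : ℤ) ^ (∑ u, ∑ v, if p u ∧ p v ∧ whiteLabel u < whiteLabel v ∧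
      blackLabel (σ v) < blackLabel (σ u) then 1 else 0)
  have h1 := neg_one_pow_mul_self (∑ u, ∑ v, if ¬ p u ∧ (p v ∧ ((σ v).1 : ℕ) + 1 = v.1) ∧ (u.1 : ℕ) = v.1 ∧
    (u.2 : ℕ) < v.2 then 1 else 0)
  have h2 := neg_one_pow_mul_self (∑ u, ∑ v, if ¬ p u ∧ (p v ∧ ((σ v).1 : ℕ) + 1 = v.1) ∧
    ((σ u).1 : ℕ) = (σ v).1 ∧ ((σ v).2 : ℕ) < (σ u).2 then 1 else 0)
  generalize (-1 : ℤ) ^ (∑ u, ∑ v, if ¬ p u ∧ (p v ∧ ((σ v).1 : ℕ) + 1 = v.1) ∧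
    (u.1 : ℕ) = v.1 ∧ (u.2 : ℕ) < v.2 then 1 else 0) = B at *
  generalize (-1 : ℤ) ^ (∑ u, ∑ v, if ¬ p u ∧ (p v ∧ ((σ v).1 : ℕ) + 1 = v.1) ∧
    ((σ u).1 : ℕ) = (σ v).1 ∧ ((σ v).2 : ℕ) < (σ u).2 then 1 else 0) = C at *
  linear_combination (-A * ∏ u, (if p u then kasteleyn m u (σ u) else 1)) * (C * C * h1 + h2)

/-- The number of rising edges in a perfect matching of the Aztec diamond. -/
def rowExcess (m : ℕ) : ℕ := ∑ u : White m, (u.1 : ℕ) - ∑ c : Black m, (c.1 : ℕ)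

theorem downCount_add_eq_rowExcess {m : ℕ} (σ : White m ≃ Black m) (p : White m → Prop)
    [DecidablePred p]
    (hadj : ∀ u, p u → Adjacent u (σ u)) (hle : ∀ u, ¬ p u → ((σ u).1 : ℕ) ≤ u.1) :
    downCount σ p + ∑ u, (if p u then 0 else (u.1 : ℕ) - (σ u).1) = rowExcess m := by
  have h : ∑ u : White m, (u.1 : ℕ) = ∑ c : Black m, (c.1 : ℕ) +
      (downCount σ p + ∑ u, (if p u then 0 else (u.1 : ℕ) - (σ u).1)) := by
    rw [← σ.sum_comp, downCount, ← Finset.sum_add_distrib, ← Finset.sum_add_distrib]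
    refine Finset.sum_congr rfl fun u _ => ?_
    by_cases hp : p u
    · obtain ⟨-, h2⟩ := hadj u hp
      simp only [hp, true_and, if_true]
      split_ifs <;> omega
    · have := hle u hp
      simp only [hp, false_and, if_false]
      omega
  rw [rowExcess, h]
  omega

theorem sign_eq_of_perm {m : ℕ} (τ : Equiv.Perm (White m)) (σ : White m ≃ Black m)
    (hσ : ∀ u, σ u = whiteEquivBlack m (τ u)) :
    (Equiv.Perm.sign τ : ℤ) = (-1) ^ (∑ u, ∑ v, if whiteLabel u < whiteLabel v ∧
      blackLabel (σ v) < blackLabel (σ u) then 1 else 0) := by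
  simp only [hσ, blackLabel_whiteEquivBlack]
  convert sign_eq_neg_one_pow_card_inversions whiteLabel whiteLabel_injective τ

theorem neg_one_pow_eq_of_mod_two_eq {a b : ℕ} (h : a % 2 = b % 2) : (-1 : ℤ) ^ a = (-1) ^ b := by
  rw [neg_one_pow_eq_pow_mod_two, h, ← neg_one_pow_eq_pow_mod_two]

theorem sign_mul_prod_kasteleyn {m : ℕ} (τ : Equiv.Perm (White m)) (σ : White m ≃ Black m)
    (hσ : ∀ u, σ u = whiteEquivBlack m (τ u)) (hadj : ∀ u, Adjacent u (σ u)) :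
    (Equiv.Perm.sign τ : ℤ) * ∏ u, kasteleyn m u (σ u) = (-1) ^ ((m + 1) * rowExcess m) := by
  have h := neg_one_pow_inversions_mul_prod σ (fun _ => True) (fun u _ => hadj u)
  have h2 := downCount_add_eq_rowExcess σ (fun _ => True) (fun u _ => hadj u) (by simp)
  simp only [if_true, Finset.sum_const_zero, add_zero] at h2
  simp only [h2, true_and, not_true_eq_false, false_and, if_false, Finset.sum_const_zero, add_zero,
    if_true] at h
  rw [sign_eq_of_perm τ σ hσ]
  exact h

theorem sum_inversions_eq_add {m : ℕ} (τ : Equiv.Perm (White m)) (σ : White m ≃ Black m)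
    (hσ : ∀ u, σ u = whiteEquivBlack m (τ u)) (w : White m) :
    (∑ u, ∑ v, if whiteLabel u < whiteLabel v ∧ blackLabel (σ v) < blackLabel (σ u)
      then 1 else 0) + 2 * (∑ u, if whiteLabel u < whiteLabel w ∧
        blackLabel (σ u) < blackLabel (σ w) then 1 else 0) =
    (∑ u, ∑ v, if u ≠ w ∧ v ≠ w ∧ whiteLabel u < whiteLabel v ∧
      blackLabel (σ v) < blackLabel (σ u) then 1 else 0) + whiteLabel w + blackLabel (σ w) := by
  have hinj : ∀ u, whiteLabel u < whiteLabel w → blackLabel (σ u) ≠ blackLabel (σ w) := by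
    intro u hu h
    rw [hσ, hσ, blackLabel_whiteEquivBlack, blackLabel_whiteEquivBlack] at h
    rw [τ.injective (whiteLabel_injective h)] at hu
    exact lt_irrefl _ hu
  have hinj2 : ∀ u, blackLabel (σ u) < blackLabel (σ w) → whiteLabel u ≠ whiteLabel w := by
    intro u hu h
    rw [whiteLabel_injective h] at hu
    exact lt_irrefl _ hu
  have h1 : (∑ u, if whiteLabel u < whiteLabel w ∧ blackLabel (σ w) < blackLabel (σ u)
      then 1 else 0) + (∑ u, if whiteLabel u < whiteLabel w ∧
        blackLabel (σ u) < blackLabel (σ w) then 1 else 0) = whiteLabel w := by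
    rw [← Finset.sum_add_distrib]
    conv_rhs => rw [← card_whiteLabel_lt w, Finset.card_filter]
    refine Finset.sum_congr rfl fun u _ => ?_
    have := hinj u
    split_ifs <;> omega
  have h2 : (∑ u, if whiteLabel w < whiteLabel u ∧ blackLabel (σ u) < blackLabel (σ w)
      then 1 else 0) + (∑ u, if whiteLabel u < whiteLabel w ∧
        blackLabel (σ u) < blackLabel (σ w) then 1 else 0) = blackLabel (σ w) := by
    rw [← Finset.sum_add_distrib]
    have e : blackLabel (σ w) = ∑ u, if blackLabel (σ u) < blackLabel (σ w) then 1 else 0 := by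
      simp only [hσ, blackLabel_whiteEquivBlack]
      rw [Equiv.sum_comp τ (fun u : White m => if whiteLabel u < whiteLabel (τ w) then 1 else 0),
        ← Finset.card_filter, card_whiteLabel_lt]
    conv_rhs => rw [e]
    refine Finset.sum_congr rfl fun u _ => ?_
    have := hinj2 u
    split_ifs <;> omega
  have h3 : (∑ u, ∑ v, if whiteLabel u < whiteLabel v ∧ blackLabel (σ v) < blackLabel (σ u)
      then 1 else 0) = (∑ u, ∑ v, if u ≠ w ∧ v ≠ w ∧ whiteLabel u < whiteLabel v ∧
      blackLabel (σ v) < blackLabel (σ u) then 1 else 0) +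
      (∑ u, if whiteLabel u < whiteLabel w ∧ blackLabel (σ w) < blackLabel (σ u)
      then 1 else 0) + (∑ u, if whiteLabel w < whiteLabel u ∧ blackLabel (σ u) < blackLabel (σ w)
      then 1 else 0) := by
    have e1 : (∑ u, if whiteLabel u < whiteLabel w ∧ blackLabel (σ w) < blackLabel (σ u)
      then 1 else 0) = ∑ u, ∑ v, if v = w then (if whiteLabel u < whiteLabel v ∧
        blackLabel (σ v) < blackLabel (σ u) then 1 else 0) else 0 := by
      simp
    have e2 : (∑ v, if whiteLabel w < whiteLabel v ∧ blackLabel (σ v) < blackLabel (σ w)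
      then 1 else 0) = ∑ u, ∑ v, if u = w then (if whiteLabel u < whiteLabel v ∧
        blackLabel (σ v) < blackLabel (σ u) then 1 else 0) else 0 := by
      rw [Finset.sum_comm]
      simp
    rw [e1, e2]
    simp only [← Finset.sum_add_distrib]
    refine Finset.sum_congr rfl fun u _ => Finset.sum_congr rfl fun v _ => ?_
    by_cases hu : u = w <;> by_cases hv : v = w
    · subst hu; subst hv; simp
    · simp [hu, hv]
    · simp [hu, hv]
    · simp [hu, hv]
  omega

/-- The number of such edges ending in the row of `w` depends only on that row. -/
theorem sum_down_row {m : ℕ} (σ : White m ≃ Black m) (w : White m)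
    (hadj : ∀ u, u ≠ w → Adjacent u (σ u)) (hw : ((σ w).1 : ℕ) < w.1) :
    (∑ v, if (v ≠ w ∧ ((σ v).1 : ℕ) + 1 = v.1) ∧ (v.1 : ℕ) = w.1 then 1 else 0) + 1 =
      (w.1 : ℕ) := by
  have h1 : ∑ u : White m, (if (w.1 : ℕ) ≤ u.1 then 1 else 0) = (m + 2 - w.1) * (m + 1) := by
    have : (Finset.univ.filter fun u : White m => (w.1 : ℕ) ≤ u.1) =
        Finset.Ici w.1 ×ˢ Finset.univ := by
      ext ⟨a, b⟩
      simp only [Finset.mem_filter, Finset.mem_univ, true_and, Finset.mem_product, and_true,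
        Finset.mem_Ici, Fin.le_def]
    rw [← Finset.card_filter, this, Finset.card_product]
    simp
  have h2 : ∑ c : Black m, (if (w.1 : ℕ) ≤ c.1 then 1 else 0) = (m + 1 - w.1) * (m + 2) := by
    rw [Fintype.sum_prod_type_right]
    have : (Finset.range (m + 1)).filter (fun i => (w.1 : ℕ) ≤ i) =
        Finset.Ico (w.1 : ℕ) (m + 1) := by
      ext i; simp; tauto
    simp only [Fin.sum_univ_eq_sum_range (fun i => if (w.1 : ℕ) ≤ i then 1 else 0),
      ← Finset.card_filter, this, Nat.card_Ico]
    simp [mul_comm]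
  have h3 : ∑ u : White m, (if (w.1 : ℕ) ≤ u.1 then 1 else 0) =
      ∑ c : Black m, (if (w.1 : ℕ) ≤ c.1 then 1 else 0) +
      ((∑ v, if (v ≠ w ∧ ((σ v).1 : ℕ) + 1 = v.1) ∧ (v.1 : ℕ) = w.1 then 1 else 0) +
        ∑ v, if v = w then 1 else 0) := by
    conv_rhs => rw [← σ.sum_comp]
    rw [← Finset.sum_add_distrib, ← Finset.sum_add_distrib]
    refine Finset.sum_congr rfl fun u _ => ?_
    by_cases hu : u = w
    · subst hu; simp [hw]
    · have := (hadj u hu).2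
      simp only [hu, ne_eq, not_false_eq_true, true_and, if_false]
      split_ifs <;> omega
  rw [Finset.sum_ite_eq' Finset.univ w, if_pos (Finset.mem_univ _)] at h3
  rw [h1, h2] at h3
  obtain ⟨k, hk⟩ : ∃ k, m + 1 = w.1 + k := ⟨m + 1 - w.1, by omega⟩
  rw [show m + 2 - (w.1 : ℕ) = k + 1 by omega, show m + 1 - (w.1 : ℕ) = k by omega] at h3
  have : (k + 1) * (m + 1) = k * (m + 2) + w.1 := by
    have e1 : k * (m + 2) = k * (m + 1) + k := by ring
    have e2 : (k + 1) * (m + 1) = k * (m + 1) + (m + 1) := by ring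
    omega
  omega

/-- The number of edges `v — σ v` that rise from the row of the black hole `σ w`, to the left of it,
plus the number of those that rise to the row of the white hole `w`, to the left of it. -/
noncomputable def crossingCount {m : ℕ} (σ : White m ≃ Black m) (w : White m) : ℕ :=
  (∑ v, if (v ≠ w ∧ ((σ v).1 : ℕ) + 1 = v.1) ∧ ((σ v).1 : ℕ) = (σ w).1 ∧
    ((σ v).2 : ℕ) < (σ w).2 then 1 else 0) +
  ∑ v, if (v ≠ w ∧ ((σ v).1 : ℕ) + 1 = v.1) ∧ (v.1 : ℕ) = w.1 ∧ (v.2 : ℕ) < w.2 then 1 else 0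

theorem sign_mul_prod_kasteleyn_erase {m : ℕ} (τ : Equiv.Perm (White m)) (σ : White m ≃ Black m)
    (hσ : ∀ u, σ u = whiteEquivBlack m (τ u)) (w : White m)
    (hadj : ∀ u, u ≠ w → Adjacent u (σ u)) (hw : ((σ w).1 : ℕ) < w.1) :
    (-1) ^ ((m + 1) * rowExcess m) *
      ((Equiv.Perm.sign τ : ℤ) * ∏ u, (if u ≠ w then kasteleyn m u (σ u) else 1)) =
    (-1) ^ ((w.2 : ℕ) + ((σ w).2 : ℕ) + (w.1 : ℕ) + ((σ w).1 : ℕ) + 1 +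
      crossingCount σ w) := by
  rw [crossingCount]
  have h := neg_one_pow_inversions_mul_prod σ (fun u => u ≠ w) hadj
  have hd := downCount_add_eq_rowExcess σ (fun u => u ≠ w) hadj
    (fun u hu => by rw [not_not.1 hu]; exact hw.le)
  have hd' : ∑ u, (if u ≠ w then 0 else (u.1 : ℕ) - (σ u).1) = (w.1 : ℕ) - (σ w).1 := by
    simp [ite_not]
  rw [hd'] at hd
  have hc1 : (∑ u, ∑ v, if ¬ u ≠ w ∧ (v ≠ w ∧ ((σ v).1 : ℕ) + 1 = v.1) ∧ (u.1 : ℕ) = v.1 ∧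
      (u.2 : ℕ) < v.2 then 1 else 0) = ∑ v, if (v ≠ w ∧ ((σ v).1 : ℕ) + 1 = v.1) ∧
      (v.1 : ℕ) = w.1 ∧ (w.2 : ℕ) < v.2 then 1 else 0 := by
    rw [Finset.sum_comm]
    refine Finset.sum_congr rfl fun v _ => ?_
    rw [Finset.sum_eq_single w]
    · simp [eq_comm]
    · intro u _ hu; simp [hu]
    · simp
  have hc2 : (∑ u, ∑ v, if ¬ u ≠ w ∧ (v ≠ w ∧ ((σ v).1 : ℕ) + 1 = v.1) ∧ ((σ u).1 : ℕ) = (σ v).1 ∧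
      ((σ v).2 : ℕ) < (σ u).2 then 1 else 0) = ∑ v, if (v ≠ w ∧ ((σ v).1 : ℕ) + 1 = v.1) ∧
      ((σ v).1 : ℕ) = (σ w).1 ∧ ((σ v).2 : ℕ) < (σ w).2 then 1 else 0 := by
    rw [Finset.sum_comm]
    refine Finset.sum_congr rfl fun v _ => ?_
    rw [Finset.sum_eq_single w]
    · simp [eq_comm]
    · intro u _ hu; simp [hu]
    · simp
  have hr := sum_down_row σ w hadj hw
  have hr' : (∑ v, if (v ≠ w ∧ ((σ v).1 : ℕ) + 1 = v.1) ∧ (v.1 : ℕ) = w.1 then 1 else 0) =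
      (∑ v, if (v ≠ w ∧ ((σ v).1 : ℕ) + 1 = v.1) ∧ (v.1 : ℕ) = w.1 ∧ (w.2 : ℕ) < v.2
        then 1 else 0) +
      ∑ v, if (v ≠ w ∧ ((σ v).1 : ℕ) + 1 = v.1) ∧ (v.1 : ℕ) = w.1 ∧ (v.2 : ℕ) < w.2
        then 1 else 0 := by
    rw [← Finset.sum_add_distrib]
    refine Finset.sum_congr rfl fun v _ => ?_
    by_cases hv : v = w
    · simp [hv]
    · have : (v.1 : ℕ) = w.1 → (v.2 : ℕ) ≠ w.2 := fun h1 h2 =>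
        hv (Prod.ext (Fin.ext h1) (Fin.ext h2))
      simp only [ne_eq, hv, not_false_eq_true, true_and]
      split_ifs <;> omega
  have hi := sum_inversions_eq_add τ σ hσ w
  rw [hc1, hc2] at h
  rw [sign_eq_of_perm τ σ hσ]
  generalize (∑ v, if (v ≠ w ∧ ((σ v).1 : ℕ) + 1 = v.1) ∧ (v.1 : ℕ) = w.1 ∧ (w.2 : ℕ) < v.2
    then 1 else 0) = c1 at *
  generalize (∑ v, if (v ≠ w ∧ ((σ v).1 : ℕ) + 1 = v.1) ∧ (v.1 : ℕ) = w.1 ∧ (v.2 : ℕ) < w.2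
    then 1 else 0) = k at *
  generalize (∑ v, if (v ≠ w ∧ ((σ v).1 : ℕ) + 1 = v.1) ∧ ((σ v).1 : ℕ) = (σ w).1 ∧
      ((σ v).2 : ℕ) < (σ w).2 then 1 else 0) = c2 at *
  generalize (∑ u, ∑ v, if u ≠ w ∧ v ≠ w ∧ whiteLabel u < whiteLabel v ∧
      blackLabel (σ v) < blackLabel (σ u) then 1 else 0) = I at *
  generalize (∑ u, ∑ v, if whiteLabel u < whiteLabel v ∧
      blackLabel (σ v) < blackLabel (σ u) then 1 else 0) = J at *
  generalize (∑ u, if whiteLabel u < whiteLabel w ∧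
        blackLabel (σ u) < blackLabel (σ w) then 1 else 0) = N at *
  have hJ : (-1 : ℤ) ^ J = (-1) ^ (whiteLabel w + blackLabel (σ w)) * (-1) ^ I := by
    rw [← pow_add]
    exact neg_one_pow_eq_of_mod_two_eq (by omega)
  rw [hJ, mul_assoc, h, ← pow_add, ← pow_add]
  apply neg_one_pow_eq_of_mod_two_eq
  rw [← hd, whiteLabel, blackLabel]
  obtain ⟨t, ht⟩ : ∃ t, (w.1 : ℕ) = (σ w).1 + t := ⟨w.1 - (σ w).1, by omega⟩
  rw [hr'] at hr
  rw [show (w.1 : ℕ) - (σ w).1 = t by omega, ht]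
  generalize downCount σ (fun u => u ≠ w) = D at *
  have e : (m + 1) * (D + t) + ((w.2 : ℕ) + (m + 1) * ((σ w).1 + t) + ((σ w).2 + (m + 2) * (σ w).1) +
      ((m + 1) * D + c1 + c2)) =
      2 * ((m + 1) * (D + t + (σ w).1)) + (w.2 + (σ w).2 + (σ w).1 + c1 + c2) := by ring
  rw [e]
  omega

theorem kasteleyn_eq_zero {m : ℕ} {u : White m} {c : Black m} (h : ¬ Adjacent u c) :
    kasteleyn m u c = 0 := by
  simp only [Adjacent] at h
  simp only [kasteleyn]
  split_ifs <;> omega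

theorem det_kasteleynSquare (m : ℕ) : (kasteleynSquare m).det =
    (-1) ^ ((m + 1) * rowExcess m) * 2 ^ (m + 1 + (m + 1) * m / 2) := by
  have hnonneg : 0 ≤ (-1 : ℤ) ^ ((m + 1) * rowExcess m) * (kasteleynSquare m).det := by
    rw [← Matrix.det_transpose, Matrix.det_apply', Finset.mul_sum]
    refine Finset.sum_nonneg fun τ _ => ?_
    simp only [Matrix.transpose_apply, kasteleynSquare, Matrix.submatrix_apply, id, Int.cast_id]
    by_cases h : ∀ u, Adjacent u (whiteEquivBlack m (τ u))
    · have := sign_mul_prod_kasteleyn τ (τ.trans (whiteEquivBlack m)) (fun _ => rfl) h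
      simp only [Equiv.trans_apply] at this
      rw [this, neg_one_pow_mul_self]
      exact zero_le_one
    · push Not at h
      obtain ⟨u, hu⟩ := h
      rw [Finset.prod_eq_zero (Finset.mem_univ u) (kasteleyn_eq_zero hu), mul_zero, mul_zero]
  have hsq : ((-1 : ℤ) ^ ((m + 1) * rowExcess m) * (kasteleynSquare m).det) ^ 2 =
      (2 ^ (m + 1 + (m + 1) * m / 2)) ^ 2 := by
    rw [mul_pow, det_kasteleynSquare_sq, sq, neg_one_pow_mul_self, one_mul, ← pow_mul]
    congr 1
    have h2 : 2 ∣ (m + 1) * m := by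
      rw [mul_comm]; exact (Nat.even_mul_succ_self m).two_dvd
    have h3 : (m + 1) * (m + 2) = 2 * (m + 1) + (m + 1) * m := by ring
    omega
  rw [← (pow_left_inj₀ hnonneg (by positivity) two_ne_zero).1 hsq, ← mul_assoc,
    neg_one_pow_mul_self, one_mul]

theorem sum_neg_one_pow_crossingCount {m : ℕ} (w : White m) (b : Black m)
    (hw : (b.1 : ℕ) < w.1) :
    ∑ σ : White m ≃ Black m, (if σ w = b ∧ ∀ u, u ≠ w → Adjacent u (σ u) then
      (-1 : ℤ) ^ crossingCount σ w else 0) =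
    (-1) ^ ((m + 1) * rowExcess m + ((w.2 : ℕ) + (b.2 : ℕ) + (w.1 : ℕ) + (b.1 : ℕ) + 1)) *
      (kasteleynSquare m).adjugate ((whiteEquivBlack m).symm b) w := by
  rw [Matrix.adjugate_apply, ← Matrix.det_transpose, Matrix.det_apply', Finset.mul_sum,
    ← (Equiv.equivCongr (Equiv.refl (White m)) (whiteEquivBlack m)).sum_comp]
  refine Finset.sum_congr rfl fun τ _ => ?_
  set σ := Equiv.equivCongr (Equiv.refl (White m)) (whiteEquivBlack m) τ with hσ
  have hστ : ∀ u, σ u = whiteEquivBlack m (τ u) := fun u => rfl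
  have hprod : ∏ u, ((kasteleynSquare m).updateRow w
      (Pi.single ((whiteEquivBlack m).symm b) 1)).transpose (τ u) u =
      (if σ w = b then 1 else 0) * ∏ u, (if u ≠ w then kasteleyn m u (σ u) else 1) := by
    rw [← Finset.mul_prod_erase _ _ (Finset.mem_univ w),
      ← Finset.mul_prod_erase Finset.univ (fun u => if u ≠ w then kasteleyn m u (σ u) else 1)
        (Finset.mem_univ w)]
    simp only [ne_eq, not_true_eq_false, if_false, one_mul]
    congr 1
    · simp [Pi.single_apply, hστ, Equiv.eq_symm_apply]
    · refine Finset.prod_congr rfl fun u hu => ?_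
      have hu' : u ≠ w := (Finset.mem_erase.1 hu).1
      simp [hu', Matrix.updateRow_ne, kasteleynSquare, hστ]
  rw [hprod]
  by_cases hb : σ w = b
  · by_cases h : ∀ u, u ≠ w → Adjacent u (σ u)
    · rw [if_pos ⟨hb, h⟩, if_pos hb, one_mul]
      have := sign_mul_prod_kasteleyn_erase τ σ hστ w h (hb ▸ hw)
      rw [hb] at this
      have h1 := neg_one_pow_mul_self ((w.2 : ℕ) + (b.2 : ℕ) + (w.1 : ℕ) + (b.1 : ℕ) + 1)
      rw [pow_add _ _ (crossingCount σ w)] at this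
      rw [Int.cast_id, pow_add]
      linear_combination -(-1 : ℤ) ^ crossingCount σ w * h1 -
        (-1) ^ ((w.2 : ℕ) + (b.2 : ℕ) + (w.1 : ℕ) + (b.1 : ℕ) + 1) * this
    · rw [if_neg (fun h' => h h'.2)]
      push Not at h
      obtain ⟨u, hu, hu'⟩ := h
      rw [Finset.prod_eq_zero (Finset.mem_univ u) (by rw [if_pos hu, kasteleyn_eq_zero hu'])]
      simp
  · rw [if_neg (fun h' => hb h'.1), if_neg hb]
    simp

theorem sum_neg_one_pow_crossingCount_eq {m : ℕ} (w : White m) (b : Black m)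
    (hw : (b.1 : ℕ) < w.1) (hw' : (w.2 : ℕ) < b.2) :
    ∑ σ : White m ≃ Black m, (if σ w = b ∧ ∀ u, u ≠ w → Adjacent u (σ u) then
      (-1 : ℤ) ^ crossingCount σ w else 0) =
    (-1) ^ (b.1 : ℕ) * 2 ^ ((m + 1) * m / 2) * ∑ j ∈ Finset.range (w.2 + 1),
      Kr j (m + 1) w.1 * Kr b.1 m (m + 1 - (j + (b.2 - w.2))) := by
  have h := adjugate_kasteleynSquare m b w
  rw [det_kasteleynSquare, green_apply m b w hw', pow_add 2 (m + 1) ((m + 1) * m / 2)] at h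
  rw [sum_neg_one_pow_crossingCount w b hw]
  have h2 : (2 : ℤ) ^ (m + 1) ≠ 0 := by positivity
  apply mul_left_cancel₀ h2
  rw [mul_left_comm, h]
  have e : (-1 : ℤ) ^ (b.1 : ℕ) = (-1) ^ ((m + 1) * rowExcess m + ((w.2 : ℕ) + (b.2 : ℕ) +
      (w.1 : ℕ) + (b.1 : ℕ) + 1)) * (-1) ^ ((m + 1) * rowExcess m) *
      (-1) ^ ((w.1 : ℕ) + ((b.2 : ℕ) - w.2 - 1)) := by
    rw [← pow_add, ← pow_add]
    exact neg_one_pow_eq_of_mod_two_eq (by omega)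
  rw [e]
  ring

def whiteVertex {m : ℕ} (u : White m) : Bool × ℕ × ℕ := (false, (u.2 + 1, u.1 + 1))

def blackVertex {m : ℕ} (c : Black m) : Bool × ℕ × ℕ := (true, (c.2 + 1, c.1 + 1))

theorem whiteVertex_injective {m : ℕ} : Function.Injective (whiteVertex (m := m)) := by
  intro u v h
  simp only [whiteVertex, Prod.mk.injEq, add_left_inj, true_and, Fin.val_inj] at h
  exact Prod.ext h.2 h.1

theorem blackVertex_injective {m : ℕ} : Function.Injective (blackVertex (m := m)) := by
  intro u v h
  simp only [blackVertex, Prod.mk.injEq, add_left_inj, true_and, Fin.val_inj] at h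
  exact Prod.ext h.2 h.1

theorem whiteVertex_ne_blackVertex {m : ℕ} (u : White m) (c : Black m) :
    whiteVertex u ≠ blackVertex c := fun h => Bool.noConfusion (congrArg Prod.fst h)

theorem coloredGrid_adj_iff {m : ℕ} (u : White m) (c : Black m) :
    coloredGrid.Adj (whiteVertex u) (blackVertex c) ↔ Adjacent u c := by
  simp [coloredGrid, whiteVertex, blackVertex, adjC, Adjacent]

theorem not_coloredGrid_adj_white {m : ℕ} (u v : White m) :
    ¬ coloredGrid.Adj (whiteVertex u) (whiteVertex v) := by
  simp [coloredGrid, whiteVertex]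

theorem not_coloredGrid_adj_black {m : ℕ} (c d : Black m) :
    ¬ coloredGrid.Adj (blackVertex c) (blackVertex d) := by
  simp [coloredGrid, blackVertex]

theorem mem_aztecVerts_iff {m : ℕ} (v : Bool × ℕ × ℕ) : v ∈ aztecVerts (m + 1) ↔
    (∃ u : White m, v = whiteVertex u) ∨ ∃ c : Black m, v = blackVertex c := by
  obtain ⟨t, x, y⟩ := v
  simp only [aztecVerts, Set.mem_ofPred_eq, whiteVertex, blackVertex, Prod.mk.injEq]
  constructor
  · rintro (⟨rfl, h1, h2, h3, h4⟩ | ⟨rfl, h1, h2, h3, h4⟩)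
    · exact Or.inl ⟨(⟨y - 1, by omega⟩, ⟨x - 1, by omega⟩), rfl, by simp; omega, by simp; omega⟩
    · exact Or.inr ⟨(⟨y - 1, by omega⟩, ⟨x - 1, by omega⟩), rfl, by simp; omega, by simp; omega⟩
  · rintro (⟨u, rfl, rfl, rfl⟩ | ⟨c, rfl, rfl, rfl⟩)
    · exact Or.inl ⟨rfl, by omega⟩
    · exact Or.inr ⟨rfl, by omega⟩

theorem mem_aztecVerts_diff_iff {m : ℕ} (w : White m) (b : Black m) (v : Bool × ℕ × ℕ) :
    v ∈ aztecVerts (m + 1) \ {whiteVertex w, blackVertex b} ↔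
    (∃ u, u ≠ w ∧ v = whiteVertex u) ∨ ∃ c, c ≠ b ∧ v = blackVertex c := by
  simp only [Set.mem_sdiff, mem_aztecVerts_iff, Set.mem_insert_iff, Set.mem_singleton_iff]
  constructor
  · rintro ⟨⟨u, rfl⟩ | ⟨c, rfl⟩, h⟩
    · exact Or.inl ⟨u, fun hu => h (Or.inl (hu ▸ rfl)), rfl⟩
    · exact Or.inr ⟨c, fun hc => h (Or.inr (hc ▸ rfl)), rfl⟩
  · rintro (⟨u, hu, rfl⟩ | ⟨c, hc, rfl⟩)
    · exact ⟨Or.inl ⟨u, rfl⟩, fun h => h.elim (fun h => hu (whiteVertex_injective h))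
        (whiteVertex_ne_blackVertex _ _)⟩
    · exact ⟨Or.inr ⟨c, rfl⟩, fun h => h.elim (fun h => whiteVertex_ne_blackVertex _ _ h.symm)
        (fun h => hc (blackVertex_injective h))⟩

/-- The edges `u — σ u`, `u ≠ w`, as a subgraph of the grid. -/
def matchingSubgraph {m : ℕ} (w : White m) (b : Black m) (σ : White m ≃ Black m) (hb : σ w = b)
    (hadj : ∀ u, u ≠ w → Adjacent u (σ u)) : coloredGrid.Subgraph where
  verts := aztecVerts (m + 1) \ {whiteVertex w, blackVertex b}
  Adj p q := ∃ u, u ≠ w ∧ ((p = whiteVertex u ∧ q = blackVertex (σ u)) ∨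
    (p = blackVertex (σ u) ∧ q = whiteVertex u))
  adj_sub := by
    rintro p q ⟨u, hu, ⟨rfl, rfl⟩ | ⟨rfl, rfl⟩⟩
    · exact (coloredGrid_adj_iff _ _).2 (hadj u hu)
    · exact ((coloredGrid_adj_iff _ _).2 (hadj u hu)).symm
  edge_vert := by
    rintro p q ⟨u, hu, ⟨rfl, rfl⟩ | ⟨rfl, rfl⟩⟩
    · exact (mem_aztecVerts_diff_iff w b _).2 (Or.inl ⟨u, hu, rfl⟩)
    · exact (mem_aztecVerts_diff_iff w b _).2
        (Or.inr ⟨σ u, fun h => hu (σ.injective (h.trans hb.symm)), rfl⟩)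
  symm := by
    constructor
    rintro p q ⟨u, hu, h⟩
    exact ⟨u, hu, by tauto⟩

theorem matchingSubgraph_adj_iff {m : ℕ} {w : White m} {b : Black m} {σ : White m ≃ Black m}
    (hb : σ w = b) (hadj : ∀ u, u ≠ w → Adjacent u (σ u)) (p q : ℕ × ℕ) :
    (matchingSubgraph w b σ hb hadj).Adj (false, p) (true, q) ↔
      ∃ u, u ≠ w ∧ p = ((u.2 : ℕ) + 1, (u.1 : ℕ) + 1) ∧
        q = (((σ u).2 : ℕ) + 1, ((σ u).1 : ℕ) + 1) := by
  simp [matchingSubgraph, whiteVertex, blackVertex]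

theorem matchingSubgraph_isMatching {m : ℕ} (w : White m) (b : Black m) (σ : White m ≃ Black m)
    (hb : σ w = b) (hadj : ∀ u, u ≠ w → Adjacent u (σ u)) :
    (matchingSubgraph w b σ hb hadj).IsMatching := by
  intro v hv
  rcases (mem_aztecVerts_diff_iff w b v).1 hv with ⟨u, hu, rfl⟩ | ⟨c, hc, rfl⟩
  · refine ⟨blackVertex (σ u), ⟨u, hu, Or.inl ⟨rfl, rfl⟩⟩, ?_⟩
    rintro q ⟨u', hu', ⟨h, rfl⟩ | ⟨h, rfl⟩⟩
    · rw [whiteVertex_injective h]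
    · exact (whiteVertex_ne_blackVertex _ _ h).elim
  · refine ⟨whiteVertex (σ.symm c), ⟨σ.symm c, ?_, Or.inr ⟨by simp, rfl⟩⟩, ?_⟩
    · rintro h
      exact hc (by rw [← hb, ← h, Equiv.apply_symm_apply])
    · rintro q ⟨u', hu', ⟨h, rfl⟩ | ⟨h, rfl⟩⟩
      · exact (whiteVertex_ne_blackVertex _ _ h.symm).elim
      · rw [blackVertex_injective h, Equiv.symm_apply_apply]

theorem exists_eq_matchingSubgraph {m : ℕ} (w : White m) (b : Black m) (M : coloredGrid.Subgraph)
    (hM : M.verts = aztecVerts (m + 1) \ {whiteVertex w, blackVertex b}) (hM' : M.IsMatching) :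
    ∃ (σ : White m ≃ Black m) (hb : σ w = b) (hadj : ∀ u, u ≠ w → Adjacent u (σ u)),
      matchingSubgraph w b σ hb hadj = M := by
  have hmem : ∀ v, v ∈ M.verts ↔ (∃ u, u ≠ w ∧ v = whiteVertex u) ∨
      ∃ c, c ≠ b ∧ v = blackVertex c := fun v => by rw [hM, mem_aztecVerts_diff_iff]
  have hex : ∀ u, ∃ c, (u = w → c = b) ∧ (u ≠ w → c ≠ b ∧ M.Adj (whiteVertex u) (blackVertex c)) := by
    intro u
    by_cases hu : u = w
    · exact ⟨b, fun _ => rfl, fun h => (h hu).elim⟩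
    · obtain ⟨q, hq, -⟩ := hM' ((hmem _).2 (Or.inl ⟨u, hu, rfl⟩))
      rcases (hmem q).1 (M.edge_vert hq.symm) with ⟨u', -, rfl⟩ | ⟨c, hc, rfl⟩
      · exact (not_coloredGrid_adj_white _ _ (M.adj_sub hq)).elim
      · exact ⟨c, fun h => (hu h).elim, fun _ => ⟨hc, hq⟩⟩
  choose f hfw hf using hex
  have hinj : Function.Injective f := by
    intro u v huv
    by_cases hu : u = w <;> by_cases hv : v = w
    · rw [hu, hv]
    · exact ((hf v hv).1 (huv ▸ hfw u hu)).elim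
    · exact ((hf u hu).1 (huv ▸ hfw v hv)).elim
    · have h1 := (hf u hu).2
      have h2 := (hf v hv).2
      rw [huv] at h1
      exact whiteVertex_injective (hM'.eq_of_adj_right h1 h2)
  let σ : White m ≃ Black m := Equiv.ofBijective f
    ((Fintype.bijective_iff_injective_and_card f).2
      ⟨hinj, Fintype.card_congr (whiteEquivBlack m)⟩)
  have hσ : ∀ u, σ u = f u := fun _ => rfl
  refine ⟨σ, hfw w rfl, fun u hu => (coloredGrid_adj_iff _ _).1 (M.adj_sub (hf u hu).2), ?_⟩
  refine SimpleGraph.Subgraph.ext hM.symm ?_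
  ext p q
  constructor
  · rintro ⟨u, hu, ⟨rfl, rfl⟩ | ⟨rfl, rfl⟩⟩
    · exact (hf u hu).2
    · exact (hf u hu).2.symm
  · intro h
    rcases (hmem p).1 (M.edge_vert h) with ⟨u, hu, rfl⟩ | ⟨c, hc, rfl⟩
    · exact ⟨u, hu, Or.inl ⟨rfl, hM'.eq_of_adj_left h (hf u hu).2⟩⟩
    · rcases (hmem q).1 (M.edge_vert h.symm) with ⟨u, hu, rfl⟩ | ⟨d, hd, rfl⟩
      · exact ⟨u, hu, Or.inr ⟨hM'.eq_of_adj_left h.symm (hf u hu).2, rfl⟩⟩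
      · exact (not_coloredGrid_adj_black _ _ (M.adj_sub h)).elim

theorem natCard_subtype_eq_sum {ι : Type*} [Fintype ι] {P : ℕ → Prop} {Q : ι → Prop}
    [DecidablePred Q] (f : ι → ℕ) (hf : ∀ v, Q v → P (f v))
    (hinj : ∀ v v', Q v → Q v' → f v = f v' → v = v') (hsurj : ∀ i, P i → ∃ v, Q v ∧ f v = i) :
    Nat.card {i // P i} = ∑ v, if Q v then 1 else 0 := by
  rw [← Finset.card_filter, ← Fintype.card_subtype, ← Nat.card_eq_fintype_card]
  refine (Nat.card_eq_of_bijective (fun v : {v // Q v} => (⟨f v, hf v v.2⟩ : {i // P i}))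
    ⟨fun v v' h => Subtype.ext (hinj v v' v.2 v'.2 (congrArg Subtype.val h)), fun i => ?_⟩).symm
  obtain ⟨v, hv, h⟩ := hsurj i i.2
  exact ⟨⟨v, hv⟩, Subtype.ext h⟩

theorem natCard_add_eq_crossingCount {m : ℕ} {w : White m} {b : Black m} {σ : White m ≃ Black m}
    (hb : σ w = b) (hadj : ∀ u, u ≠ w → Adjacent u (σ u)) :
    Nat.card {i : ℕ // 1 < i ∧ i < (b.2 : ℕ) + 1 ∧ (matchingSubgraph w b σ hb hadj).Adj
        (false, (i - 1, (b.1 : ℕ) + 1 + 1)) (true, (i, (b.1 : ℕ) + 1))} +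
      Nat.card {i : ℕ // 1 ≤ i ∧ i < (b.2 : ℕ) + 1 ∧ (matchingSubgraph w b σ hb hadj).Adj
        (false, (i, (b.1 : ℕ) + 1 + 1)) (true, (i, (b.1 : ℕ) + 1))} +
      Nat.card {i : ℕ // 1 ≤ i ∧ i < (w.2 : ℕ) + 1 ∧ (matchingSubgraph w b σ hb hadj).Adj
        (false, (i, (w.1 : ℕ) + 1)) (true, (i, (w.1 : ℕ)))} +
      Nat.card {i : ℕ // 1 ≤ i ∧ i < (w.2 : ℕ) + 1 ∧ (matchingSubgraph w b σ hb hadj).Adj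
        (false, (i, (w.1 : ℕ) + 1)) (true, (i + 1, (w.1 : ℕ)))} = crossingCount σ w := by
  simp only [matchingSubgraph_adj_iff, Prod.mk.injEq]
  have hval : ∀ v v', ((σ v).1 : ℕ) = (σ v').1 → ((σ v).2 : ℕ) = (σ v').2 → v = v' :=
    fun v v' h1 h2 => σ.injective (Prod.ext (Fin.ext h1) (Fin.ext h2))
  have hval' : ∀ v v' : White m, (v.1 : ℕ) = v'.1 → (v.2 : ℕ) = v'.2 → v = v' :=
    fun v v' h1 h2 => Prod.ext (Fin.ext h1) (Fin.ext h2)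
  rw [natCard_subtype_eq_sum (Q := fun v => ((v ≠ w ∧ ((σ v).1 : ℕ) + 1 = v.1) ∧
      ((σ v).1 : ℕ) = b.1 ∧ ((σ v).2 : ℕ) < b.2) ∧ ((σ v).2 : ℕ) = v.2 + 1)
      (fun v => ((σ v).2 : ℕ) + 1)
      (fun v hv => ⟨by omega, by omega, v, hv.1.1.1, by omega, by omega⟩)
      (fun v v' hv hv' h => hval v v' (by omega) (by omega))
      (fun i ⟨h1, h2, v, h3, h4, h5⟩ => ⟨v, ⟨⟨⟨h3, by omega⟩, by omega⟩, by omega⟩, by omega⟩),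
    natCard_subtype_eq_sum (Q := fun v => ((v ≠ w ∧ ((σ v).1 : ℕ) + 1 = v.1) ∧
      ((σ v).1 : ℕ) = b.1 ∧ ((σ v).2 : ℕ) < b.2) ∧ ((σ v).2 : ℕ) = v.2)
      (fun v => ((σ v).2 : ℕ) + 1)
      (fun v hv => ⟨by omega, by omega, v, hv.1.1.1, by omega, by omega⟩)
      (fun v v' hv hv' h => hval v v' (by omega) (by omega))
      (fun i ⟨h1, h2, v, h3, h4, h5⟩ => ⟨v, ⟨⟨⟨h3, by omega⟩, by omega⟩, by omega⟩, by omega⟩),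
    natCard_subtype_eq_sum (Q := fun v => ((v ≠ w ∧ ((σ v).1 : ℕ) + 1 = v.1) ∧
      (v.1 : ℕ) = w.1 ∧ (v.2 : ℕ) < w.2) ∧ ((σ v).2 : ℕ) = v.2)
      (fun v => (v.2 : ℕ) + 1)
      (fun v hv => ⟨by omega, by omega, v, hv.1.1.1, by omega, by omega⟩)
      (fun v v' hv hv' h => hval' v v' (by omega) (by omega))
      (fun i ⟨h1, h2, v, h3, h4, h5⟩ => ⟨v, ⟨⟨⟨h3, by omega⟩, by omega⟩, by omega⟩, by omega⟩),
    natCard_subtype_eq_sum (Q := fun v => ((v ≠ w ∧ ((σ v).1 : ℕ) + 1 = v.1) ∧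
      (v.1 : ℕ) = w.1 ∧ (v.2 : ℕ) < w.2) ∧ ((σ v).2 : ℕ) = v.2 + 1)
      (fun v => (v.2 : ℕ) + 1)
      (fun v hv => ⟨by omega, by omega, v, hv.1.1.1, by omega, by omega⟩)
      (fun v v' hv hv' h => hval' v v' (by omega) (by omega))
      (fun i ⟨h1, h2, v, h3, h4, h5⟩ => ⟨v, ⟨⟨⟨h3, by omega⟩, by omega⟩, by omega⟩, by omega⟩),
    crossingCount, hb, add_assoc]
  congr 1 <;> rw [← Finset.sum_add_distrib] <;> refine Finset.sum_congr rfl fun v _ => ?_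
  all_goals
    by_cases hv : v = w
    · simp [hv]
    · have h := (hadj v hv).1
      simp only [ne_eq, hv, not_false_eq_true, true_and]
      split_ifs <;> omega

/-- Weighted count for an Aztec diamond with two holes: for the Aztec diamond of order `n`
with the white vertex `(w₀, w₁+d₁)` and the black vertex `(w₀+d₀, w₁)` deleted, the sum of
`(-1)^(w T)` over all perfect matchings `T` — where `w T` is the total number of edges of `T`
of the four indicated kinds — equals
`(-1)^(w₁+1) · 2^(n(n-1)/2) · ∑_{j=0}^{w₀-1} Kr j n (w₁+d₁-1) · Kr (w₁-1) (n-1) (n-(j+d₀))`. -/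
theorem weighted_count_two_holes (n w₀ w₁ d₀ d₁ : ℕ) (hn : 1 ≤ n)
    (hd₀ : 1 ≤ d₀) (hd₁ : 1 ≤ d₁) (hw₀ : 1 ≤ w₀) (hw₀d : w₀ + d₀ ≤ n + 1)
    (hw₁ : 1 ≤ w₁) (hw₁n : w₁ ≤ n) (hw₁d : w₁ + d₁ ≤ n + 1) :
    (∑ᶠ M : {M : coloredGrid.Subgraph //
        M.verts = aztecVerts n \
          {((false : Bool), (w₀, w₁ + d₁)), ((true : Bool), (w₀ + d₀, w₁))} ∧
        M.IsMatching},
      (-1 : ℤ) ^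
        (Nat.card {i : ℕ // 1 < i ∧ i < w₀ + d₀ ∧
            M.val.Adj (false, (i - 1, w₁ + 1)) (true, (i, w₁))} +
         Nat.card {i : ℕ // 1 ≤ i ∧ i < w₀ + d₀ ∧
            M.val.Adj (false, (i, w₁ + 1)) (true, (i, w₁))} +
         Nat.card {i : ℕ // 1 ≤ i ∧ i < w₀ ∧
            M.val.Adj (false, (i, w₁ + d₁)) (true, (i, w₁ + d₁ - 1))} +
         Nat.card {i : ℕ // 1 ≤ i ∧ i < w₀ ∧
            M.val.Adj (false, (i, w₁ + d₁)) (true, (i + 1, w₁ + d₁ - 1))}))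
    = (-1 : ℤ) ^ (w₁ + 1) * 2 ^ (n * (n - 1) / 2) *
        ∑ j ∈ Finset.range w₀,
          Kr j n (w₁ + d₁ - 1) * Kr (w₁ - 1) (n - 1) (n - (j + d₀)) := by
  obtain ⟨m, rfl⟩ : ∃ m, n = m + 1 := ⟨n - 1, by omega⟩
  obtain ⟨w, hw1, hw2⟩ : ∃ w : White m, w₁ + d₁ = (w.1 : ℕ) + 1 ∧ w₀ = (w.2 : ℕ) + 1 :=
    ⟨(⟨w₁ + d₁ - 1, by omega⟩, ⟨w₀ - 1, by omega⟩), by simp; omega, by simp; omega⟩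
  obtain ⟨b, hb1, hb2⟩ : ∃ b : Black m, w₁ = (b.1 : ℕ) + 1 ∧ w₀ + d₀ = (b.2 : ℕ) + 1 :=
    ⟨(⟨w₁ - 1, by omega⟩, ⟨w₀ + d₀ - 1, by omega⟩), by simp; omega, by simp; omega⟩
  have hd : d₀ = (b.2 : ℕ) - w.2 := by omega
  have hb : (b.1 : ℕ) < w.1 := by omega
  have hb' : (w.2 : ℕ) < b.2 := by omega
  have key := sum_neg_one_pow_crossingCount_eq w b hb hb'
  rw [hw1, hb2, hb1, hw2]
  simp only [hd, add_tsub_cancel_right]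
  rw [pow_add _ _ 1, pow_one, pow_add _ _ 1, pow_one, mul_assoc _ (-1 : ℤ) (-1),
    neg_one_mul, neg_neg, mul_one, ← key, ← Finset.sum_filter,
    Finset.sum_subtype (p := fun σ : White m ≃ Black m => σ w = b ∧
      ∀ u, u ≠ w → Adjacent u (σ u)) _ (by simp), ← finsum_eq_sum_of_fintype]
  refine (finsum_eq_of_bijective (fun σ => ⟨matchingSubgraph w b σ.1 σ.2.1 σ.2.2, rfl,
    matchingSubgraph_isMatching _ _ _ _ _⟩) ⟨?_, ?_⟩ ?_).symm
  · intro σ σ' h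
    have h' : matchingSubgraph w b σ.1 σ.2.1 σ.2.2 = matchingSubgraph w b σ'.1 σ'.2.1 σ'.2.2 :=
      congrArg Subtype.val h
    refine Subtype.ext (Equiv.ext fun u => ?_)
    by_cases hu : u = w
    · rw [hu, σ.2.1, σ'.2.1]
    · have h1 : (matchingSubgraph w b σ.1 σ.2.1 σ.2.2).Adj (whiteVertex u)
          (blackVertex (σ.1 u)) := ⟨u, hu, Or.inl ⟨rfl, rfl⟩⟩
      have h2 : (matchingSubgraph w b σ'.1 σ'.2.1 σ'.2.2).Adj (whiteVertex u)
          (blackVertex (σ'.1 u)) := ⟨u, hu, Or.inl ⟨rfl, rfl⟩⟩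
      rw [h'] at h1
      exact blackVertex_injective
        ((matchingSubgraph_isMatching _ _ _ _ _).eq_of_adj_left h1 h2)
  · rintro ⟨M, hM, hM'⟩
    obtain ⟨σ, hb, hadj, h⟩ := exists_eq_matchingSubgraph w b M hM hM'
    exact ⟨⟨σ, hb, hadj⟩, Subtype.ext h⟩
  · intro σ
    rw [← natCard_add_eq_crossingCount σ.2.1 σ.2.2]
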